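/- Let (G,E) be a self-similar action, let (α,g,β),(γ,h,δ) ∈ S(G,E), and let ξ be a finite or infinite path of which β is a prefix. Then (α,g,β) and (γ,h,δ) admit a common lower bound (ε,k,ζ) ∈ S(G,E)∖{0} (i.e. (ε,k,ζ) ≤ (α,g,β) and (ε,k,ζ) ≤ (γ,h,δ)) such that ζ is a prefix of ξ, if and only if there are β',δ' ∈ E^* satisfying α(g·β') = γ(h·δ'), g|_{β'} = h|_{δ'}, ββ' = δδ', and ββ' is a prefix of ξ. Furthermore, this happens if and only if either (1) α = γγ̄ and β = δδ̄ for some γ̄,δ̄ ∈ E^* with h·δ̄ = γ̄, and there is a path β' ∈ s(β)E^* strongly fixed by g⁻¹(h|_{δ̄}) such that ββ' is a prefix of ξ; or (2) γ = αᾱ and δ = ββ̄ for some ᾱ,β̄ ∈ E^* with g·β̄ = ᾱ, and there is a path δ' ∈ s(δ)E^* strongly fixed by h⁻¹(g|_{β̄}) such that δδ' is a prefix of ξ. -/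

import Mathlib

noncomputable section

attribute [local instance] Classical.propDecidable

/-- Raw algebraic data of an inverse semigroup with zero, together with a domain
predicate singling out its genuine elements (the carrier may contain junk). -/
structure RawSem (T : Type) where
  mul : T → T → T
  star : T → T
  zero : T
  dom : T → Prop

namespace RawSem

variable {T : Type} (R : RawSem T)

/-- The natural partial order: `t ≤ u` iff `t = u ⬝ t* ⬝ t`. -/
def le (t u : T) : Prop := t = R.mul u (R.mul (R.star t) t)

/-- Nonzero idempotents (belonging to the domain). -/
def NzIdem (e : T) : Prop := R.dom e ∧ R.mul e e = e ∧ e ≠ R.zero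

/-- `F` covers the idempotent `e`: every nonzero idempotent below `e` meets some `f ∈ F`. -/
def Covers (F : Set T) (e : T) : Prop :=
  ∀ z, R.NzIdem z → R.le z e → ∃ f ∈ F, R.mul z f ≠ R.zero

/-- The set `F_t` of nonzero idempotents trivially fixed by `t`, i.e. `≤ t`. -/
def TrivFix (t : T) : Set T := {e | R.NzIdem e ∧ R.le e t}

/-- The idempotent `e` is fixed by `t`:
`(t ⬝ f ⬝ t*) ⬝ f ≠ 0` for every nonzero idempotent `f ≤ e`. -/
def FixedBy (e t : T) : Prop :=
  ∀ f, R.NzIdem f → R.le f e → R.mul (R.mul (R.mul t f) (R.star t)) f ≠ R.zero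

/-- The inverse semigroup is closed. -/
def Closed : Prop :=
  ∀ t, R.dom t → ∃ F : Finset T, ↑F ⊆ R.TrivFix t ∧ ∀ e ∈ R.TrivFix t, R.Covers ↑F e

/-- The inverse semigroup is topologically free. -/
def TopFree : Prop :=
  ∀ t e, R.dom t → R.NzIdem e → R.FixedBy e t → ∃ f ∈ R.TrivFix t, R.mul f e ≠ R.zero

/-- The inverse semigroup is effective. -/
def Effective : Prop :=
  ∀ t e, R.dom t → R.NzIdem e → R.FixedBy e t →
    ∃ F : Finset T, ↑F ⊆ R.TrivFix t ∧ R.Covers (↑F) e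

/-- The inverse semigroup is minimal. -/
def Minimal : Prop :=
  ∀ e f, R.NzIdem e → R.NzIdem f → ∃ Ts : Finset T, (∀ t ∈ Ts, R.dom t) ∧
    R.Covers ((fun t => R.mul (R.mul t f) (R.star t)) '' ↑Ts) e

/-- The inverse semigroup is quasi-fundamental. -/
def QuasiFund : Prop :=
  ∀ s t, R.dom s → R.dom t → s ≠ R.zero → t ≠ R.zero →
    (∀ e, R.NzIdem e → R.mul (R.mul s e) (R.star s) = R.mul (R.mul t e) (R.star t)) →
    ∃ u, R.dom u ∧ u ≠ R.zero ∧ R.le u s ∧ R.le u t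

/-- The inverse semigroup is fundamental. -/
def Fund : Prop :=
  ∀ s t, R.dom s → R.dom t →
    (∀ e, R.NzIdem e → R.mul (R.mul s e) (R.star s) = R.mul (R.mul t e) (R.star t)) → s = t

/-- The inverse semigroup is `E*`-unitary. -/
def EUnitary : Prop := ∀ t e, R.dom t → R.NzIdem e → R.le e t → R.mul t t = t

/-- The inverse semigroup is locally contracting. -/
def LocContr : Prop :=
  ∀ e, R.NzIdem e → ∃ s, R.dom s ∧ ∃ F : Finset T, ∃ f₀ ∈ F,
    (∀ f ∈ F, R.NzIdem f ∧ R.le f (R.mul e (R.mul (R.star s) s))) ∧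
    ∀ f ∈ F, R.Covers (↑F) (R.mul (R.mul s f) (R.star s)) ∧
      R.mul f₀ (R.mul (R.mul s f) (R.star s)) = R.zero

/-- The inverse semigroup is strongly locally contracting. -/
def StrLocContr : Prop :=
  ∀ e, R.NzIdem e → ∃ s f₀ f₁, R.dom s ∧ R.NzIdem f₀ ∧ R.NzIdem f₁ ∧
    R.le f₀ f₁ ∧ R.le f₁ (R.mul e (R.mul (R.star s) s)) ∧
    R.le (R.mul (R.mul s f₁) (R.star s)) f₁ ∧
    R.mul f₀ (R.mul (R.mul s f₁) (R.star s)) = R.zero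

end RawSem

/-- A self-similar action `(G, E)` of a discrete groupoid `G` on a directed graph `E`
sharing the vertex/unit set `V`, encoded by total operations together with axioms
that hold on composable inputs.  Arrows `g` have source `gs g` and range `gr g`;
edges `e` have source `es e` and range `er e`; `g · e` (written `act g e`) and
`g |_e` (written `res g e`) are meaningful when `gs g = er e`. -/
structure SSA where
  V : Type
  G : Type
  E : Type
  gs : G → V
  gr : G → V
  es : E → V
  er : E → V
  one : V → G
  mul : G → G → G
  inv : G → G
  act : G → E → E
  res : G → E → G
  gs_one : ∀ v, gs (one v) = v
  gr_one : ∀ v, gr (one v) = v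
  gs_mul : ∀ g h, gs g = gr h → gs (mul g h) = gs h
  gr_mul : ∀ g h, gs g = gr h → gr (mul g h) = gr g
  mul_assoc' : ∀ g h k, gs g = gr h → gs h = gr k → mul (mul g h) k = mul g (mul h k)
  one_mul' : ∀ g, mul (one (gr g)) g = g
  mul_one' : ∀ g, mul g (one (gs g)) = g
  gs_inv : ∀ g, gs (inv g) = gr g
  gr_inv : ∀ g, gr (inv g) = gs g
  mul_inv' : ∀ g, mul g (inv g) = one (gr g)
  inv_mul' : ∀ g, mul (inv g) g = one (gs g)
  er_act : ∀ g e, gs g = er e → er (act g e) = gr g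
  act_one : ∀ e, act (one (er e)) e = e
  act_mul : ∀ g h e, gs g = gr h → gs h = er e → act (mul g h) e = act g (act h e)
  gs_res : ∀ g e, gs g = er e → gs (res g e) = es e
  gr_res : ∀ g e, gs g = er e → gr (res g e) = es (act g e)
  res_mul : ∀ g h e, gs g = gr h → gs h = er e →
    res (mul g h) e = mul (res g (act h e)) (res h e)

namespace SSA

/-- Finite paths in the graph: `Pth S a b` is the type of paths with range `a`
and source `b`; `cons e p` is the path `e · p`. -/
inductive Pth (S : SSA) : S.V → S.V → Type
  | nil (v : S.V) : Pth S v v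
  | cons (e : S.E) {b : S.V} (p : Pth S (S.es e) b) : Pth S (S.er e) b

/-- The path category `E^*`, bundled: a finite path with its range and source. -/
structure Path (S : SSA) where
  rng : S.V
  src : S.V
  pth : S.Pth rng src

/-- Infinite paths: sequences of edges `e₁e₂⋯` with `es eᵢ = er e_{i+1}`. -/
structure InfPath (S : SSA) where
  seq : ℕ → S.E
  chain : ∀ n, S.es (seq n) = S.er (seq (n + 1))

/-- A twist `σ = (σ_G, σ_⋈)` of the self-similar action, with values in the
unit circle `𝕋 ⊆ ℂ`. -/
structure Twist (S : SSA) where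
  σG : S.G → S.G → ℂ
  σB : S.G → S.E → ℂ
  σG_unimod : ∀ g h, S.gs g = S.gr h → ‖σG g h‖ = 1
  σB_unimod : ∀ g e, S.gs g = S.er e → ‖σB g e‖ = 1
  σG_cocycle : ∀ g h k, S.gs g = S.gr h → S.gs h = S.gr k →
    σG g h * σG (S.mul g h) k = σG h k * σG g (S.mul h k)
  σG_one_left : ∀ g, σG (S.one (S.gr g)) g = 1
  σG_one_right : ∀ g, σG g (S.one (S.gs g)) = 1
  σB_one : ∀ e, σB (S.one (S.er e)) e = 1
  σB_cocycle : ∀ g h e, S.gs g = S.gr h → S.gs h = S.er e →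
    σB h e * (starRingEnd ℂ) (σB (S.mul g h) e) * σB g (S.act h e) =
      (starRingEnd ℂ) (σG (S.res g (S.act h e)) (S.res h e)) * σG g h

variable {S : SSA}

namespace Pth

def length : ∀ {a b : S.V}, S.Pth a b → ℕ
  | _, _, .nil _ => 0
  | _, _, .cons _ p => length p + 1

def toList : ∀ {a b : S.V}, S.Pth a b → List S.E
  | _, _, .nil _ => []
  | _, _, .cons e p => e :: toList p

def comp : ∀ {a b c : S.V}, S.Pth a b → S.Pth b c → S.Pth a c
  | _, _, _, .nil _, q => q
  | _, _, _, .cons e p, q => .cons e (comp p q)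

end Pth

def Path.length (p : Path S) : ℕ := p.pth.length

def Path.toList (p : Path S) : List S.E := p.pth.toList

/-- A vertex regarded as a path of length `0`. -/
def Path.vert (S : SSA) (v : S.V) : Path S := ⟨v, v, .nil v⟩

/-- An edge regarded as a path of length `1`. -/
def Path.ofEdge (S : SSA) (e : S.E) : Path S := ⟨S.er e, S.es e, .cons e (.nil (S.es e))⟩

/-- Concatenation of paths (junk -- the first path -- when not composable). -/
def Path.comp (p q : Path S) : Path S :=
  if h : p.src = q.rng then
    ⟨p.rng, q.src, Pth.comp (cast (congrArg (S.Pth p.rng) h) p.pth) q.pth⟩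
  else p

/-- `q` is a prefix of `p`, i.e. `p` extends `q`. -/
def IsPrefix (S : SSA) (q p : Path S) : Prop :=
  ∃ r : Path S, q.src = r.rng ∧ p = q.comp r

/-- Two paths are comparable if one is a prefix of the other. -/
def Comparable (S : SSA) (p q : Path S) : Prop := IsPrefix S p q ∨ IsPrefix S q p

/-- The extended left action of groupoid arrows on finite paths,
given by the recursive recipe `g · v = r g`, `g · (e μ) = (g · e) (g|_e · μ)`. -/
def pactAux (S : SSA) : ∀ {a b : S.V}, S.G → S.Pth a b → Path S
  | _, _, g, .nil _ => Path.vert S (S.gr g)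
  | _, _, g, .cons e p => (Path.ofEdge S (S.act g e)).comp (pactAux S (S.res g e) p)

/-- The extended left action `g · μ` on finite paths. -/
def pact (S : SSA) (g : S.G) (p : Path S) : Path S := pactAux S g p.pth

/-- The extended restriction map, given by `g|_v = g` and `g|_{e μ} = (g|_e)|_μ`. -/
def presAux (S : SSA) : ∀ {a b : S.V}, S.G → S.Pth a b → S.G
  | _, _, g, .nil _ => g
  | _, _, g, .cons e p => presAux S (S.res g e) p

/-- The extended restriction map `g |_μ` on finite paths. -/
def pres (S : SSA) (g : S.G) (p : Path S) : S.G := presAux S g p.pth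

/-- `g` strongly fixes the path `p` : `g · p = p` and `g|_p = s p`. -/
def SFix (S : SSA) (g : S.G) (p : Path S) : Prop :=
  S.gs g = p.rng ∧ pact S g p = p ∧ pres S g p = S.one p.src

/-- `p` is a minimal strongly `g`-fixed path. -/
def MinSFix (S : SSA) (g : S.G) (p : Path S) : Prop :=
  SFix S g p ∧ ∀ q : Path S, IsPrefix S q p → q ≠ p → ¬ SFix S g q

/-- `g` is a unit of the groupoid (an element of `G⁰`). -/
def IsUnitArrow (S : SSA) (g : S.G) : Prop := g = S.one (S.gs g)

/-- `g` fixes every path in `s(g)E^*`. -/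
def FixesAll (S : SSA) (g : S.G) : Prop :=
  ∀ p : Path S, p.rng = S.gs g → pact S g p = p

/-- Condition (Fin): every `g` admits at most finitely many minimal strongly
`g`-fixed paths. -/
def CondFin (S : SSA) : Prop := ∀ g : S.G, {p : Path S | MinSFix S g p}.Finite

/-- Condition (Evr): if `g` fixes every path in `s(g)E^*` then `g` strongly fixes
some path in `s(g)E^*`. -/
def CondEvr (S : SSA) : Prop := ∀ g : S.G, FixesAll S g → ∃ p : Path S, SFix S g p

/-- `p` is a `g`-cycle: a path of positive length with `g · s(p) = r(p)`. -/
def GCycle (S : SSA) (g : S.G) (p : Path S) : Prop :=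
  1 ≤ p.length ∧ S.gs g = p.src ∧ S.gr g = p.rng

/-- The vertex `v` receives at least two distinct edges. -/
def HasEntranceVert (S : SSA) (v : S.V) : Prop :=
  ∃ e f : S.E, e ≠ f ∧ S.er e = v ∧ S.er f = v

/-- Base vertices of a finite path. -/
def Path.baseVerts (p : Path S) : Set S.V :=
  insert p.rng {v : S.V | ∃ e ∈ p.toList, S.es e = v}

/-- A finite path has an entrance. -/
def Path.hasEntrance (p : Path S) : Prop := ∃ v ∈ p.baseVerts, HasEntranceVert S v

/-- Condition (Cyc): every `G`-cycle has an entrance. -/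
def CondCyc (S : SSA) : Prop := ∀ (g : S.G) (p : Path S), GCycle S g p → p.hasEntrance

/-- `g` has slack. -/
def HasSlack (S : SSA) (g : S.G) : Prop :=
  ∃ F : Finset (Path S), (∀ p ∈ F, SFix S g p) ∧
    ∀ q : Path S, q.rng = S.gs g → ∃ p ∈ F, Comparable S p q

/-- Condition (Sla): if `g` fixes every path in `s(g)E^*` then `g` has slack. -/
def CondSla (S : SSA) : Prop := ∀ g : S.G, FixesAll S g → HasSlack S g

def InfPath.rng (ξ : InfPath S) : S.V := S.er (ξ.seq 0)

/-- Base vertices of an infinite path. -/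
def InfPath.baseVerts (ξ : InfPath S) : Set S.V := {v : S.V | ∃ n, S.er (ξ.seq n) = v}

/-- An infinite path has an entrance. -/
def InfPath.hasEntrance (ξ : InfPath S) : Prop := ∃ v ∈ ξ.baseVerts, HasEntranceVert S v

/-- The finite path `p` is a prefix of the infinite path `ξ`. -/
def PrefixOfInf (S : SSA) (p : Path S) (ξ : InfPath S) : Prop :=
  p.rng = ξ.rng ∧ ∀ i : ℕ, i < p.length → p.toList[i]? = some (ξ.seq i)

/-- Finite or infinite paths. -/
abbrev GenPath (S : SSA) : Type := Path S ⊕ InfPath S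

/-- The finite path `p` is a prefix of the finite or infinite path `ξ`. -/
def GPrefix (S : SSA) (p : Path S) : GenPath S → Prop
  | .inl q => IsPrefix S p q
  | .inr ξ => PrefixOfInf S p ξ

/-- The set `vE¹` of edges received by the vertex `v`. -/
def recvSet (S : SSA) (v : S.V) : Set S.E := {e : S.E | S.er e = v}

/-- A vertex is singular if it is a source or an infinite receiver. -/
def Singular (S : SSA) (v : S.V) : Prop := recvSet S v = ∅ ∨ (recvSet S v).Infinite

/-- A vertex is regular if it is not singular. -/
def Regular (S : SSA) (v : S.V) : Prop := ¬ Singular S v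

/-- The preorder `v ≪ w`: there is `v'` with `vE^*v' ≠ ∅` and `v'Gw ≠ ∅`. -/
def ll (S : SSA) (v w : S.V) : Prop :=
  ∃ (p : Path S) (g : S.G), p.rng = v ∧ S.gr g = p.src ∧ S.gs g = w

/-- Cofinality of the self-similar action: for every boundary path (a finite path
with singular source, or an infinite path) and every vertex `v`, some base vertex
`w` of the path satisfies `v ≪ w`. -/
def Cofinal (S : SSA) : Prop :=
  (∀ p : Path S, Singular S p.src → ∀ v : S.V, ∃ w ∈ p.baseVerts, ll S v w) ∧
  (∀ ξ : InfPath S, ∀ v : S.V, ∃ w ∈ ξ.baseVerts, ll S v w)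

def Hereditary (S : SSA) (W : Set S.V) : Prop :=
  ∀ v ∈ W, ∀ p : Path S, p.rng = v → p.src ∈ W

def Saturated (S : SSA) (W : Set S.V) : Prop :=
  ∀ w : S.V, Regular S w → (∀ e : S.E, S.er e = w → S.es e ∈ W) → w ∈ W

def GInvariant (S : SSA) (W : Set S.V) : Prop := ∀ g : S.G, S.gs g ∈ W → S.gr g ∈ W

/-- `(G,E)`-invariant subsets of `E⁰`: `G`-invariant, hereditary and saturated. -/
def SSAInvariant (S : SSA) (W : Set S.V) : Prop :=
  GInvariant S W ∧ Hereditary S W ∧ Saturated S W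

/-- Condition (Con): every vertex is reachable from a `G`-cycle with an entrance. -/
def CondCon (S : SSA) : Prop :=
  ∀ v : S.V, ∃ p : Path S, p.rng = v ∧
    ∃ (g : S.G) (c : Path S), GCycle S g c ∧ c.hasEntrance ∧ p.src ∈ c.baseVerts

/-- The underlying set (with zero `none`) of the inverse semigroup `S(G,E)`. -/
abbrev SGE (S : SSA) : Type := Option (Path S × S.G × Path S)

/-- Well-formedness of a triple `(α, g, β)` : `r g = s α` and `s g = s β`. -/
def SGE.wf (S : SSA) : SGE S → Prop
  | none => True
  | some (α, g, β) => S.gr g = α.src ∧ S.gs g = β.src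

/-- The idempotent `f_α = (α, s α, α)`. -/
def fIdem (S : SSA) (α : Path S) : SGE S := some (α, S.one α.src, α)

/-- The involution `(α,g,β)* = (β,g⁻¹,α)` on `S(G,E)`. -/
def sgeStar (S : SSA) : SGE S → SGE S
  | none => none
  | some (α, g, β) => some (β, S.inv g, α)

/-- The multiplication of the inverse semigroup `S(G,E)`. -/
def sgeMul (S : SSA) : SGE S → SGE S → SGE S
  | none, _ => none
  | some _, none => none
  | some (α, g, β), some (γ, h, δ) =>
    if SGE.wf S (some (α, g, β)) ∧ SGE.wf S (some (γ, h, δ)) then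
      if h1 : ∃ β' : Path S, β.src = Path.rng β' ∧ γ = β.comp β' then
        some (α.comp (pact S g h1.choose), S.mul (pres S g h1.choose) h, δ)
      else if h2 : ∃ γ' : Path S, γ.src = Path.rng γ' ∧ β = γ.comp γ' then
        some (α, S.mul g (S.inv (pres S (S.inv h) h2.choose)),
          δ.comp (pact S (S.inv h) h2.choose))
      else none
    else none

/-- Membership in the subsemigroup `S₀(G,E)` (with zero): triples with `|α| = |β|`. -/
def domS0 (S : SSA) (x : SGE S) : Prop :=
  SGE.wf S x ∧ (x = none ∨ ∃ (α : Path S) (g : S.G) (β : Path S),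
    x = some (α, g, β) ∧ α.length = β.length)

/-- Membership in the subsemigroup `S₀₀(G,E)` (with zero): triples `(g·β, g|_β, β)`. -/
def domS00 (S : SSA) (x : SGE S) : Prop :=
  SGE.wf S x ∧ (x = none ∨ ∃ (g : S.G) (β : Path S),
    S.gs g = β.rng ∧ x = some (pact S g β, pres S g β, β))

/-- `S(G,E)` as raw inverse-semigroup data. -/
def sgeSem (S : SSA) : RawSem (SGE S) := ⟨sgeMul S, sgeStar S, none, SGE.wf S⟩

/-- `S₀(G,E)` as raw inverse-semigroup data. -/
def sgeSem0 (S : SSA) : RawSem (SGE S) := ⟨sgeMul S, sgeStar S, none, domS0 S⟩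

/-- `S₀₀(G,E)` as raw inverse-semigroup data. -/
def sgeSem00 (S : SSA) : RawSem (SGE S) := ⟨sgeMul S, sgeStar S, none, domS00 S⟩

/-- The inductive extension of `σ_⋈` to finite paths:
`σ_⋈(h, s h) = 1`, `σ_⋈(h, e μ) = σ_⋈(h, e) σ_⋈(h|_e, μ)`. -/
def twAux (S : SSA) (σB : S.G → S.E → ℂ) : ∀ {a b : S.V}, S.G → S.Pth a b → ℂ
  | _, _, _, .nil _ => 1
  | _, _, g, .cons e p => σB g e * twAux S σB (S.res g e) p

/-- The extension `σ_⋈ : G * E^* → 𝕋` of a twist to finite paths. -/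
def twP (S : SSA) (σB : S.G → S.E → ℂ) (g : S.G) (p : Path S) : ℂ := twAux S σB g p.pth

/-- The `2`-cocycle `ω_σ` on `S(G,E)` induced by a twist `σ` of `(G,E)`. -/
def omg (S : SSA) (T : Twist S) : SGE S → SGE S → ℂ := fun x y =>
  match x, y with
  | some (_, g, β), some (γ, h, _) =>
    if h1 : ∃ β' : Path S, β.src = Path.rng β' ∧ γ = β.comp β' then
      twP S T.σB g h1.choose * T.σG (pres S g h1.choose) h
    else if h2 : ∃ γ' : Path S, γ.src = Path.rng γ' ∧ β = γ.comp γ' then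
      T.σG g (S.inv (pres S (S.inv h) h2.choose)) * twP S T.σB h (pact S (S.inv h) h2.choose)
    else 1
  | _, _ => 1

end SSA

namespace SSA
variable {S : SSA}

theorem aux_ext {a b : S.V} (p : S.Pth a b) : ∀ {a' c : S.V} (q : S.Pth a' c), a = a' →
    p.toList = q.toList → (⟨a, b, p⟩ : Path S) = ⟨a', c, q⟩ := by
  induction p with
  | nil v =>
    intro a' c q ha h
    cases q with
    | nil => subst ha; rfl
    | cons e q => simp [Pth.toList] at h
  | cons e p ih =>
    intro a' c q ha h
    cases q with
    | nil => simp [Pth.toList] at h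
    | cons f q =>
      simp only [Pth.toList, List.cons.injEq] at h
      obtain ⟨rfl, h⟩ := h
      have := ih q rfl h
      cases this
      rfl

theorem path_ext {p q : Path S} (h1 : p.rng = q.rng) (h2 : p.toList = q.toList) : p = q :=
  aux_ext p.pth q.pth h1 h2

theorem comp_rng (p q : Path S) : (p.comp q).rng = p.rng := by
  unfold Path.comp; split <;> rfl

theorem comp_src {p q : Path S} (h : p.src = q.rng) : (p.comp q).src = q.src := by
  unfold Path.comp; rw [dif_pos h]

theorem aux_toList : ∀ {a b c : S.V} (p : S.Pth a b) (q : S.Pth b c),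
    (p.comp q).toList = p.toList ++ q.toList
  | _, _, _, .nil _, q => by simp [Pth.comp, Pth.toList]
  | _, _, _, .cons e p, q => by simp [Pth.comp, Pth.toList, aux_toList p q]

theorem comp_toList {p q : Path S} (h : p.src = q.rng) :
    (p.comp q).toList = p.toList ++ q.toList := by
  obtain ⟨a, b, p⟩ := p
  obtain ⟨c, d, q⟩ := q
  simp only at h
  subst h
  unfold Path.comp
  rw [dif_pos rfl]
  exact aux_toList p q

theorem comp_assoc {p q r : Path S} (h : p.src = q.rng) (h' : q.src = r.rng) :
    (p.comp q).comp r = p.comp (q.comp r) := by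
  have h1 : (p.comp q).src = r.rng := (comp_src h).trans h'
  have h2 : p.src = (q.comp r).rng := h.trans (comp_rng _ _).symm
  apply path_ext
  · simp [comp_rng]
  · rw [comp_toList h1, comp_toList h, comp_toList h2, comp_toList h', List.append_assoc]

theorem comp_vert (p : Path S) : p.comp (Path.vert S p.src) = p := by
  apply path_ext
  · simp [comp_rng]
  · rw [comp_toList rfl]; simp [Path.vert, Path.toList, Pth.toList]

theorem vert_comp (p : Path S) : (Path.vert S p.rng).comp p = p := by
  apply path_ext
  · simp [comp_rng, Path.vert]
  · rw [comp_toList rfl]; simp [Path.vert, Path.toList, Pth.toList]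

theorem comp_cancel {p q r : Path S} (h : p.src = q.rng) (h' : p.src = r.rng)
    (he : p.comp q = p.comp r) : q = r := by
  apply path_ext (h.symm.trans h')
  have := congrArg Path.toList he
  rw [comp_toList h, comp_toList h'] at this
  exact List.append_cancel_left this

theorem comp_inj {p q p' q' : Path S} (h : p.src = q.rng) (h' : p'.src = q'.rng)
    (he : p.comp q = p'.comp q') (hl : q.toList.length = q'.toList.length) :
    p = p' ∧ q = q' := by
  have h1 := congrArg Path.toList he
  rw [comp_toList h, comp_toList h'] at h1
  have h2 := List.append_inj' h1 hl
  have h3 : p = p' := path_ext (by rw [← comp_rng p q, he, comp_rng]) h2.1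
  subst h3
  exact ⟨rfl, comp_cancel h h' he⟩

theorem cons_eq (e : S.E) {b : S.V} (p : S.Pth (S.es e) b) :
    (⟨S.er e, b, .cons e p⟩ : Path S) = (Path.ofEdge S e).comp ⟨S.es e, b, p⟩ := by
  unfold Path.comp
  rw [dif_pos (show (Path.ofEdge S e).src = (⟨S.es e, b, p⟩ : Path S).rng from rfl)]
  rfl

/-- Induction on paths. -/
theorem path_ind {P : Path S → Prop} (h0 : ∀ v, P (Path.vert S v))
    (h1 : ∀ e p, S.es e = p.rng → P p → P ((Path.ofEdge S e).comp p)) : ∀ p, P p := by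
  rintro ⟨a, b, p⟩
  induction p with
  | nil v => exact h0 v
  | cons e p ih => rw [cons_eq]; exact h1 e _ rfl ih

theorem pact_vert (g : S.G) (v : S.V) : pact S g (Path.vert S v) = Path.vert S (S.gr g) := rfl
theorem pres_vert (g : S.G) (v : S.V) : pres S g (Path.vert S v) = g := rfl

theorem pact_edge_comp (g : S.G) (e : S.E) (p : Path S) (h : S.es e = p.rng) :
    pact S g ((Path.ofEdge S e).comp p)
      = (Path.ofEdge S (S.act g e)).comp (pact S (S.res g e) p) := by
  obtain ⟨a, b, p⟩ := p
  simp only at h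
  subst h
  rw [← cons_eq]; rfl

theorem pres_edge_comp (g : S.G) (e : S.E) (p : Path S) (h : S.es e = p.rng) :
    pres S g ((Path.ofEdge S e).comp p) = pres S (S.res g e) p := by
  obtain ⟨a, b, p⟩ := p
  simp only at h
  subst h
  rw [← cons_eq]; rfl

theorem pact_spec (p : Path S) : ∀ g, S.gs g = p.rng →
    (pact S g p).rng = S.gr g ∧ (pact S g p).src = S.gr (pres S g p) ∧
    S.gs (pres S g p) = p.src ∧ (pact S g p).toList.length = p.toList.length := by
  induction p using path_ind with
  | h0 v => intro g hg; exact ⟨rfl, rfl, hg, rfl⟩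
  | h1 e p he ih =>
    intro g hg
    have hg' : S.gs g = S.er e := hg.trans (comp_rng _ _)
    obtain ⟨i1, i2, i3, i4⟩ := ih (S.res g e) ((S.gs_res g e hg').trans he)
    have hc : (Path.ofEdge S (S.act g e)).src = (pact S (S.res g e) p).rng := by
      rw [i1, S.gr_res g e hg']; rfl
    have hc' : (Path.ofEdge S e).src = p.rng := he
    rw [pact_edge_comp g e p he, pres_edge_comp g e p he, comp_rng, comp_src hc, comp_src hc',
      comp_toList hc, comp_toList hc']
    refine ⟨S.er_act g e hg', i2, i3, ?_⟩
    simp [i4, Path.ofEdge, Path.toList, Pth.toList] 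
    exact i4

theorem pact_comp (p q : Path S) (hpq : p.src = q.rng) : ∀ g, S.gs g = p.rng →
    pact S g (p.comp q) = (pact S g p).comp (pact S (pres S g p) q) ∧
    pres S g (p.comp q) = pres S (pres S g p) q := by
  induction p using path_ind with
  | h0 v =>
    intro g hg
    have hv : v = q.rng := hpq
    subst hv
    have h1 := (pact_spec q g hg).1
    rw [vert_comp, pact_vert, pres_vert, ← h1, vert_comp]
    exact ⟨rfl, rfl⟩
  | h1 e p he ih =>
    intro g hg
    have hg' : S.gs g = S.er e := hg.trans (comp_rng _ _)
    have hc' : (Path.ofEdge S e).src = p.rng := he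
    have hpq' : p.src = q.rng := by rw [← hpq, comp_src hc']
    have hg2 := (S.gs_res g e hg').trans he
    obtain ⟨i1, i2, i3, i4⟩ := pact_spec p (S.res g e) hg2
    have hc : (Path.ofEdge S (S.act g e)).src = (pact S (S.res g e) p).rng := by
      rw [i1, S.gr_res g e hg']; rfl
    obtain ⟨j1, j2⟩ := ih hpq' (S.res g e) hg2
    have k1 := (pact_spec q (pres S (S.res g e) p) (i3.trans hpq')).1
    rw [comp_assoc hc' hpq', pact_edge_comp g e p he, pres_edge_comp g e p he,
      pact_edge_comp g e _ (he.trans (comp_rng _ _).symm),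
      pres_edge_comp g e _ (he.trans (comp_rng _ _).symm), j1, j2,
      comp_assoc hc (i2.trans k1.symm)]
    exact ⟨rfl, rfl⟩

theorem pact_mul (p : Path S) : ∀ g h, S.gs g = S.gr h → S.gs h = p.rng →
    pact S (S.mul g h) p = pact S g (pact S h p) ∧
    pres S (S.mul g h) p = S.mul (pres S g (pact S h p)) (pres S h p) := by
  induction p using path_ind with
  | h0 v => 
    intro g h hgh hh
    rw [pact_vert, pact_vert, pact_vert, pres_vert, pres_vert, pres_vert, S.gr_mul g h hgh]
    exact ⟨rfl, rfl⟩
  | h1 e p he ih =>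
    intro g h hgh hh
    have hh' : S.gs h = S.er e := hh.trans (comp_rng _ _)
    have hga : S.gs g = S.er (S.act h e) := hgh.trans (S.er_act h e hh').symm
    have hr : S.gs (S.res h e) = p.rng := (S.gs_res h e hh').trans he
    have hrr : S.gs (S.res g (S.act h e)) = S.gr (S.res h e) := by
      rw [S.gs_res _ _ hga, S.gr_res _ _ hh']
    obtain ⟨j1, j2⟩ := ih _ _ hrr hr
    have hc : S.es (S.act h e) = (pact S (S.res h e) p).rng := by
      rw [(pact_spec p _ hr).1, S.gr_res _ _ hh']
    rw [pact_edge_comp _ e p he, pres_edge_comp _ e p he, pact_edge_comp _ e p he,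
      pres_edge_comp _ e p he, pact_edge_comp _ _ _ hc, pres_edge_comp _ _ _ hc,
      S.act_mul g h e hgh hh', S.res_mul g h e hgh hh', j1, j2]
    exact ⟨rfl, rfl⟩

theorem idem_one (g : S.G) (h : S.gs g = S.gr g) (hg : S.mul g g = g) : g = S.one (S.gs g) := by
  calc g = S.mul (S.one (S.gr g)) g := (S.one_mul' g).symm
    _ = S.mul (S.mul (S.inv g) g) g := by rw [S.inv_mul', h]
    _ = S.mul (S.inv g) (S.mul g g) := S.mul_assoc' _ _ _ (S.gs_inv g) h
    _ = S.one (S.gs g) := by rw [hg, S.inv_mul']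

theorem res_one (e : S.E) : S.res (S.one (S.er e)) e = S.one (S.es e) := by
  have h1 := S.gs_one (S.er e)
  have h2 := S.gr_one (S.er e)
  have h3 := S.res_mul _ _ e (h1.trans h2.symm) h1
  have h4 := S.one_mul' (S.one (S.er e))
  rw [h2] at h4
  rw [h4, S.act_one] at h3
  have h5 := S.gs_res _ e h1
  have h6 := S.gr_res _ e h1
  rw [S.act_one] at h6
  have := idem_one _ (h5.trans h6.symm) h3.symm
  rw [h5] at this
  exact this

theorem pact_one (p : Path S) :
    pact S (S.one p.rng) p = p ∧ pres S (S.one p.rng) p = S.one p.src := by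
  induction p using path_ind with
  | h0 v =>
    rw [pact_vert, pres_vert, S.gr_one]
    exact ⟨rfl, rfl⟩
  | h1 e p he ih =>
    have h1 : ((Path.ofEdge S e).comp p).rng = S.er e := comp_rng _ _
    rw [h1, pact_edge_comp _ e p he, pres_edge_comp _ e p he, res_one, S.act_one, he, ih.1, ih.2,
      comp_src (show (Path.ofEdge S e).src = p.rng from he)]
    exact ⟨rfl, rfl⟩

theorem inv_mul_cancel (g k : S.G) (h : S.gr g = S.gr k) :
    S.mul g (S.mul (S.inv g) k) = k := by
  rw [← S.mul_assoc' _ _ _ (S.gr_inv g).symm ((S.gs_inv g).trans h), S.mul_inv', h, S.one_mul']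

theorem sfix_iff (g k : S.G) (p : Path S) (h : S.gr g = S.gr k) (hg : S.gs g = p.rng)
    (hk : S.gs k = p.rng) :
    SFix S (S.mul (S.inv g) k) p ↔ pact S g p = pact S k p ∧ pres S g p = pres S k p := by
  have hi : S.gs (S.inv g) = S.gr k := (S.gs_inv g).trans h
  have hs : S.gs (S.mul (S.inv g) k) = p.rng := (S.gs_mul _ _ hi).trans hk
  constructor
  · rintro ⟨-, h1, h2⟩
    have hr : S.gs g = S.gr (S.mul (S.inv g) k) := by rw [S.gr_mul _ _ hi, S.gr_inv]
    have := pact_mul p g _ hr hs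
    rw [inv_mul_cancel g k h, h1, h2, ← (pact_spec p g hg).2.2.1, S.mul_one'] at this
    exact ⟨this.1.symm, this.2.symm⟩
  · rintro ⟨h1, h2⟩
    have t1 := pact_mul p _ k hi hk
    have t2 := pact_mul p (S.inv g) g (S.gs_inv g) hg
    rw [← h1, ← h2, ← t2.1, ← t2.2, S.inv_mul', hg, (pact_one p).1, (pact_one p).2] at t1
    exact ⟨hs, t1⟩

theorem star_mul_self (ε : Path S) (k : S.G) (ζ : Path S) (hw : SGE.wf S (some (ε, k, ζ))) :
    sgeMul S (sgeStar S (some (ε, k, ζ))) (some (ε, k, ζ)) = some (ζ, S.one ζ.src, ζ) := by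
  have hw' : SGE.wf S (some (ζ, S.inv k, ε)) := ⟨(S.gr_inv k).trans hw.2, (S.gs_inv k).trans hw.1⟩
  have hex : ∃ β' : Path S, ε.src = Path.rng β' ∧ ε = ε.comp β' :=
    ⟨Path.vert S ε.src, rfl, (comp_vert ε).symm⟩
  have hch : hex.choose = Path.vert S ε.src :=
    comp_cancel hex.choose_spec.1 rfl (hex.choose_spec.2.symm.trans (comp_vert ε).symm)
  simp only [sgeStar, sgeMul]
  rw [if_pos ⟨hw', hw⟩, dif_pos hex, hch, pact_vert, pres_vert, S.inv_mul', S.gr_inv, hw.2,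
    comp_vert]

theorem le_iff (ε : Path S) (k : S.G) (ζ α : Path S) (g : S.G) (β : Path S)
    (hw : SGE.wf S (some (ε, k, ζ))) (hw1 : SGE.wf S (some (α, g, β))) :
    (sgeSem S).le (some (ε, k, ζ)) (some (α, g, β)) ↔
      ∃ β' : Path S, β.src = β'.rng ∧ ζ = β.comp β' ∧ ε = α.comp (pact S g β') ∧
        k = pres S g β' := by
  have hwi : SGE.wf S (some (ζ, S.one ζ.src, ζ)) := ⟨S.gr_one _, S.gs_one _⟩
  change some (ε, k, ζ) = sgeMul S (some (α, g, β)) (sgeMul S (sgeStar S (some (ε, k, ζ))) (some (ε, k, ζ))) ↔ _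
  rw [star_mul_self ε k ζ hw]
  simp only [sgeMul]
  rw [if_pos ⟨hw1, hwi⟩]
  have key : ∀ β' : Path S, β.src = β'.rng → ζ = β.comp β' →
      S.mul (pres S g β') (S.one ζ.src) = pres S g β' := by
    intro β' h1 h2
    rw [h2, comp_src h1, ← (pact_spec β' g (hw1.2.trans h1)).2.2.1, S.mul_one']
  by_cases hex : ∃ β' : Path S, β.src = Path.rng β' ∧ ζ = β.comp β'
  · rw [dif_pos hex]
    have hs := hex.choose_spec
    generalize hex.choose = b at hs
    rw [key b hs.1 hs.2]
    constructor
    · intro h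
      simp only [Option.some.injEq, Prod.mk.injEq] at h
      exact ⟨b, hs.1, hs.2, h.1, h.2.1⟩
    · rintro ⟨b', h1, h2, h3, h4⟩
      have : b' = b := comp_cancel h1 hs.1 (h2.symm.trans hs.2)
      subst this
      rw [h3, h4]
  · rw [dif_neg hex]
    constructor
    · intro h
      exfalso
      split_ifs at h with h2
      have hs := h2.choose_spec
      generalize h2.choose = c at hs h
      simp only [Option.some.injEq, Prod.mk.injEq] at h
      have h3 := h.2.2
      have hoi : S.inv (S.one ζ.src) = S.one ζ.src := by
        have := S.mul_inv' (S.one ζ.src)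
        have h4 := S.one_mul' (S.inv (S.one ζ.src))
        rw [S.gr_inv, S.gs_one] at h4
        rw [h4, S.gr_one] at this
        exact this
      rw [hoi, hs.1, (pact_one c).1, ← hs.2] at h3
      exact hex ⟨Path.vert S β.src, rfl, by rw [comp_vert, ← h3]⟩
    · rintro ⟨b', h1, h2, -⟩
      exact absurd ⟨b', h1, h2⟩ hex

theorem split_list (l₁ l₂ : List S.E) : ∀ (p : Path S), p.toList = l₁ ++ l₂ →
    ∃ q r : Path S, q.src = r.rng ∧ p = q.comp r ∧ q.toList = l₁ := by
  induction l₁ with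
  | nil => intro p h; exact ⟨Path.vert S p.rng, p, rfl, (vert_comp p).symm, rfl⟩
  | cons e l ih =>
    intro p
    induction p using path_ind with
    | h0 v => intro h; simp [Path.vert, Path.toList, Pth.toList] at h
    | h1 f p hf _ =>
      intro h
      rw [comp_toList (show (Path.ofEdge S f).src = p.rng from hf)] at h
      have h' : f = e ∧ p.toList = l ++ l₂ := List.cons_eq_cons.1 h
      obtain ⟨rfl, h'⟩ := h'
      obtain ⟨q, r, hqr, hp, hq⟩ := ih p h'
      have hfq : (Path.ofEdge S f).src = q.rng := by
        rw [hp, comp_rng] at hf; exact hf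
      refine ⟨(Path.ofEdge S f).comp q, r, (comp_src hfq).trans hqr, ?_, ?_⟩
      · rw [comp_assoc hfq hqr, ← hp]
      · rw [comp_toList hfq, hq]; rfl

theorem levi {β β' δ δ' : Path S} (h1 : β.src = β'.rng) (h2 : δ.src = δ'.rng)
    (h : β.comp β' = δ.comp δ') :
    (∃ d : Path S, δ.src = d.rng ∧ β = δ.comp d ∧ δ' = d.comp β') ∨
    (∃ d : Path S, β.src = d.rng ∧ δ = β.comp d ∧ β' = d.comp δ') := by
  have main : ∀ {β β' δ δ' : Path S} (_ : β.src = β'.rng) (_ : δ.src = δ'.rng)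
      (_ : β.comp β' = δ.comp δ') (l : List S.E) (_ : β.toList = δ.toList ++ l)
      (_ : δ'.toList = l ++ β'.toList),
      (∃ d : Path S, δ.src = d.rng ∧ β = δ.comp d ∧ δ' = d.comp β') := by
    intro β β' δ δ' h1 h2 h l hl hl'
    obtain ⟨q, r, hqr, hp, hq⟩ := split_list l _ δ' hl'
    have h3 : δ.src = q.rng := by rw [h2, hp, comp_rng]
    have h4 : β = δ.comp q := by
      apply path_ext
      · rw [comp_rng, ← comp_rng β β', h, comp_rng]
      · rw [comp_toList h3, hl, hq]
    refine ⟨q, h3, h4, ?_⟩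
    have h5 : q.src = β'.rng := by rw [← h1, h4, comp_src h3]
    apply path_ext
    · rw [comp_rng, ← h2, h3]
    · rw [comp_toList h5, hl', hq]
  have hl := congrArg Path.toList h
  rw [comp_toList h1, comp_toList h2] at hl
  rcases List.append_eq_append_iff.1 hl with ⟨l, a, b⟩ | ⟨l, a, b⟩
  · exact Or.inr (main h2 h1 h.symm l a b)
  · exact Or.inl (main h1 h2 h l a b)

/-- Half of the second equivalence, left to right. -/
theorem half_mp {α : Path S} {g : S.G} {β γ : Path S} {h : S.G} {δ β' d : Path S}
    (hw1 : SGE.wf S (some (α, g, β))) (hw2 : SGE.wf S (some (γ, h, δ)))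
    (h1 : β.src = β'.rng) (hd : δ.src = d.rng) (hβ : β = δ.comp d)
    (he : α.comp (pact S g β') = γ.comp (pact S h (d.comp β')))
    (hr : pres S g β' = pres S h (d.comp β')) :
    γ.src = (pact S h d).rng ∧ α = γ.comp (pact S h d) ∧
      SFix S (S.mul (S.inv g) (pres S h d)) β' := by
  have hg : S.gs g = β'.rng := hw1.2.trans h1
  have hh : S.gs h = d.rng := hw2.2.trans hd
  have hdβ : d.src = β'.rng := by rw [← h1, hβ, comp_src hd]
  obtain ⟨a1, a2, a3, a4⟩ := pact_spec β' g hg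
  obtain ⟨b1, b2, b3, b4⟩ := pact_spec d h hh
  have hk := b3.trans hdβ
  obtain ⟨c1, c2, c3, c4⟩ := pact_spec β' _ hk
  obtain ⟨e1, e2⟩ := pact_comp d β' hdβ h hh
  have hγ : γ.src = (pact S h d).rng := by rw [b1]; exact hw2.1.symm
  have hm : (pact S h d).src = (pact S (pres S h d) β').rng := b2.trans c1.symm
  rw [e1, ← comp_assoc hγ hm] at he
  obtain ⟨f1, f2⟩ := comp_inj (by rw [a1]; exact hw1.1.symm) (by rw [comp_src hγ, hm]) he
    (a4.trans c4.symm)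
  refine ⟨hγ, f1, ?_⟩
  rw [sfix_iff _ _ _ _ hg hk]
  · exact ⟨f2, hr.trans e2⟩
  · rw [show S.gr g = α.src from hw1.1, f1, comp_src hγ, b2]

/-- Half of the second equivalence, right to left. -/
theorem half_mpr {α : Path S} {g : S.G} {β γ : Path S} {h : S.G} {δ β' d : Path S}
    (hw1 : SGE.wf S (some (α, g, β))) (hw2 : SGE.wf S (some (γ, h, δ)))
    (h1 : β.src = β'.rng) (hd : δ.src = d.rng) (hβ : β = δ.comp d)
    (hα : α = γ.comp (pact S h d))
    (hf : SFix S (S.mul (S.inv g) (pres S h d)) β') :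
    δ.src = (d.comp β').rng ∧ α.comp (pact S g β') = γ.comp (pact S h (d.comp β')) ∧
      pres S g β' = pres S h (d.comp β') ∧ β.comp β' = δ.comp (d.comp β') := by
  have hg : S.gs g = β'.rng := hw1.2.trans h1
  have hh : S.gs h = d.rng := hw2.2.trans hd
  have hdβ : d.src = β'.rng := by rw [← h1, hβ, comp_src hd]
  obtain ⟨b1, b2, b3, b4⟩ := pact_spec d h hh
  have hk := b3.trans hdβ
  obtain ⟨c1, c2, c3, c4⟩ := pact_spec β' _ hk
  obtain ⟨e1, e2⟩ := pact_comp d β' hdβ h hh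
  have hγ : γ.src = (pact S h d).rng := by rw [b1]; exact hw2.1.symm
  have hm : (pact S h d).src = (pact S (pres S h d) β').rng := b2.trans c1.symm
  rw [sfix_iff _ _ _ (by rw [show S.gr g = α.src from hw1.1, hα, comp_src hγ, b2]) hg hk] at hf
  refine ⟨hd.trans (comp_rng _ _).symm, ?_, hf.2.trans e2.symm, ?_⟩
  · rw [e1, ← comp_assoc hγ hm, ← hα, hf.1]
  · rw [hβ, comp_assoc hd hdβ]

end SSA

/-- Characterisation of common lower bounds in `S(G,E)` relative
to a finite or infinite path `ξ` of which `β` is a prefix. -/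
theorem statement18 (S : SSA) (α : SSA.Path S) (g : S.G) (β γ : SSA.Path S) (h : S.G)
    (δ : SSA.Path S) (ξ : SSA.GenPath S)
    (hwf₁ : SSA.SGE.wf S (some (α, g, β))) (hwf₂ : SSA.SGE.wf S (some (γ, h, δ)))
    (hpre : SSA.GPrefix S β ξ) :
    ((∃ (ε : SSA.Path S) (k : S.G) (ζ : SSA.Path S), SSA.SGE.wf S (some (ε, k, ζ)) ∧
        (SSA.sgeSem S).le (some (ε, k, ζ)) (some (α, g, β)) ∧
        (SSA.sgeSem S).le (some (ε, k, ζ)) (some (γ, h, δ)) ∧ SSA.GPrefix S ζ ξ) ↔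
      (∃ β' δ' : SSA.Path S, β.src = β'.rng ∧ δ.src = δ'.rng ∧
        α.comp (SSA.pact S g β') = γ.comp (SSA.pact S h δ') ∧
        SSA.pres S g β' = SSA.pres S h δ' ∧ β.comp β' = δ.comp δ' ∧
        SSA.GPrefix S (β.comp β') ξ)) ∧
    ((∃ (ε : SSA.Path S) (k : S.G) (ζ : SSA.Path S), SSA.SGE.wf S (some (ε, k, ζ)) ∧
        (SSA.sgeSem S).le (some (ε, k, ζ)) (some (α, g, β)) ∧
        (SSA.sgeSem S).le (some (ε, k, ζ)) (some (γ, h, δ)) ∧ SSA.GPrefix S ζ ξ) ↔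
      ((∃ gb db : SSA.Path S, γ.src = gb.rng ∧ α = γ.comp gb ∧ δ.src = db.rng ∧
          β = δ.comp db ∧ SSA.pact S h db = gb ∧
          ∃ β' : SSA.Path S, β.src = β'.rng ∧
            SSA.SFix S (S.mul (S.inv g) (SSA.pres S h db)) β' ∧
            SSA.GPrefix S (β.comp β') ξ) ∨
        (∃ ab bb : SSA.Path S, α.src = ab.rng ∧ γ = α.comp ab ∧ β.src = bb.rng ∧
          δ = β.comp bb ∧ SSA.pact S g bb = ab ∧
          ∃ δ' : SSA.Path S, δ.src = δ'.rng ∧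
            SSA.SFix S (S.mul (S.inv h) (SSA.pres S g bb)) δ' ∧
            SSA.GPrefix S (δ.comp δ') ξ))) := by
  have first : ((∃ (ε : SSA.Path S) (k : S.G) (ζ : SSA.Path S), SSA.SGE.wf S (some (ε, k, ζ)) ∧
        (SSA.sgeSem S).le (some (ε, k, ζ)) (some (α, g, β)) ∧
        (SSA.sgeSem S).le (some (ε, k, ζ)) (some (γ, h, δ)) ∧ SSA.GPrefix S ζ ξ) ↔
      (∃ β' δ' : SSA.Path S, β.src = β'.rng ∧ δ.src = δ'.rng ∧
        α.comp (SSA.pact S g β') = γ.comp (SSA.pact S h δ') ∧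
        SSA.pres S g β' = SSA.pres S h δ' ∧ β.comp β' = δ.comp δ' ∧
        SSA.GPrefix S (β.comp β') ξ)) := by
    constructor
    · rintro ⟨ε, k, ζ, hw, hl1, hl2, hp⟩
      rw [SSA.le_iff _ _ _ _ _ _ hw hwf₁] at hl1
      rw [SSA.le_iff _ _ _ _ _ _ hw hwf₂] at hl2
      obtain ⟨b, b1, b2, b3, b4⟩ := hl1
      obtain ⟨d, d1, d2, d3, d4⟩ := hl2
      exact ⟨b, d, b1, d1, b3.symm.trans d3, b4.symm.trans d4, b2.symm.trans d2, b2 ▸ hp⟩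
    · rintro ⟨b, d, b1, d1, e1, e2, e3, hp⟩
      have hg : S.gs g = b.rng := hwf₁.2.trans b1
      obtain ⟨a1, a2, a3, a4⟩ := SSA.pact_spec b g hg
      have hα : α.src = (SSA.pact S g b).rng := by rw [a1]; exact hwf₁.1.symm
      have hw : SSA.SGE.wf S (some (α.comp (SSA.pact S g b), SSA.pres S g b, β.comp b)) :=
        ⟨by rw [SSA.comp_src hα, a2], by rw [SSA.comp_src b1, a3]⟩
      refine ⟨_, _, _, hw, ?_, ?_, hp⟩
      · rw [SSA.le_iff _ _ _ _ _ _ hw hwf₁]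
        exact ⟨b, b1, rfl, rfl, rfl⟩
      · rw [SSA.le_iff _ _ _ _ _ _ hw hwf₂]
        exact ⟨d, d1, e3, e1, e2⟩
  refine ⟨first, first.trans ?_⟩
  constructor
  · rintro ⟨b, d, b1, d1, e1, e2, e3, hp⟩
    rcases SSA.levi b1 d1 e3 with ⟨x, x1, x2, rfl⟩ | ⟨x, x1, x2, rfl⟩
    · obtain ⟨y1, y2, y3⟩ := SSA.half_mp hwf₁ hwf₂ b1 x1 x2 e1 e2
      exact Or.inl ⟨_, x, y1, y2, x1, x2, rfl, b, b1, y3, hp⟩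
    · obtain ⟨y1, y2, y3⟩ := SSA.half_mp hwf₂ hwf₁ d1 x1 x2 e1.symm e2.symm
      exact Or.inr ⟨_, x, y1, y2, x1, x2, rfl, d, d1, y3, e3 ▸ hp⟩
  · rintro (⟨_, x, y1, y2, x1, x2, rfl, b, b1, y3, hp⟩ | ⟨_, x, y1, y2, x1, x2, rfl, d, d1, y3, hp⟩)
    · obtain ⟨z1, z2, z3, z4⟩ := SSA.half_mpr hwf₁ hwf₂ b1 x1 x2 y2 y3
      exact ⟨b, x.comp b, b1, z1, z2, z3, z4, hp⟩
    · obtain ⟨z1, z2, z3, z4⟩ := SSA.half_mpr hwf₂ hwf₁ d1 x1 x2 y2 y3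
      exact ⟨x.comp d, d, z1, d1, z2.symm, z3.symm, z4.symm, z4 ▸ hp⟩

end
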